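/- arXiv:2110.06520 — 2 statements merged into one kernel-verified Lean document; each statement's English description precedes it below -/
import Mathlib

section
/- The function Φ(x) := x + G(x/q_max) is differentiable on (0, q_max) with derivative Φ′(x) = 1 − e^{−k(x/q_max)}; in particular 0 < Φ′(x) < 1, so Φ is strictly increasing on [0, q_max]. -/
open Real MeasureTheory

/-- Channel capacity `C(u) = B·log₂(1 + Ψ·u/(r^β·(Υ+1)))`. -/
noncomputable def Cchan (B Psi Ups r β : ℝ) (u : ℝ) : ℝ :=
  B * Real.logb 2 (1 + Psi * u / (r ^ β * (Ups + 1)))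

/-- Threshold `k(α) = r^β·((Υ+1)/Ψ)·(2^{A·q_max·(1−α)/(T·B)} − 1)`. -/
noncomputable def kThr (B Psi Ups T A qmax r β : ℝ) (α : ℝ) : ℝ :=
  r ^ β * ((Ups + 1) / Psi) * ((2 : ℝ) ^ (A * qmax * (1 - α) / (T * B)) - 1)

/-- Expected delivered quality `G(α) = ∫₀^∞ min{C(u)·T/A, q_max·(1−α)}·e^{−u} du`. -/
noncomputable def Gfun (B Psi Ups T A qmax r β : ℝ) (α : ℝ) : ℝ :=
  ∫ u in Set.Ioi (0 : ℝ),
    min (Cchan B Psi Ups r β u * T / A) (qmax * (1 - α)) * Real.exp (-u)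

lemma aux_key (B Psi Ups T A qmax r β : ℝ)
    (hB : 0 < B) (hPsi : 0 < Psi) (hUps : 0 < Ups) (hT : 0 < T)
    (hA : 0 < A) (hr : 0 < r) (α u : ℝ) (hu : 0 < u) :
    (Cchan B Psi Ups r β u * T / A < qmax * (1 - α) ↔ u < kThr B Psi Ups T A qmax r β α) ∧
    (qmax * (1 - α) < Cchan B Psi Ups r β u * T / A ↔ kThr B Psi Ups T A qmax r β α < u) := by
  have hR : 0 < r ^ β := Real.rpow_pos_of_pos hr β
  have hU : 0 < Ups + 1 := by linarith
  unfold Cchan kThr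
  set R := r ^ β
  have hpos : 0 < 1 + Psi * u / (R * (Ups + 1)) := by positivity
  set L := logb 2 (1 + Psi * u / (R * (Ups + 1))) with hL
  set s := A * qmax * (1 - α) / (T * B) with hs
  have e1 : B * L * T / A = (T * B / A) * L := by ring
  have e2 : qmax * (1 - α) = (T * B / A) * s := by rw [hs]; field_simp
  have hc : 0 < T * B / A := by positivity
  have hd : 0 < R * ((Ups + 1) / Psi) := by positivity
  have e3 : u = R * ((Ups + 1) / Psi) * ((1 + Psi * u / (R * (Ups + 1))) - 1) := by
    field_simp; ring
  rw [e1, e2, mul_lt_mul_iff_right₀ hc, mul_lt_mul_iff_right₀ hc, hL,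
    Real.logb_lt_iff_lt_rpow one_lt_two hpos, Real.lt_logb_iff_rpow_lt one_lt_two hpos]
  constructor
  · conv_rhs => lhs; rw [e3]
    rw [mul_lt_mul_iff_right₀ hd, sub_lt_sub_iff_right]
  · conv_rhs => rhs; rw [e3]
    rw [mul_lt_mul_iff_right₀ hd, sub_lt_sub_iff_right]

lemma aux_deriv (B Psi Ups T A qmax r β : ℝ)
    (hB : 0 < B) (hPsi : 0 < Psi) (hUps : 0 < Ups) (hT : 0 < T)
    (hA : 0 < A) (hq : 0 < qmax) (hr : 0 < r) (x : ℝ) (hx : x ≤ qmax)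
    (hk : 0 ≤ kThr B Psi Ups T A qmax r β (x / qmax)) :
    HasDerivAt (fun y => Gfun B Psi Ups T A qmax r β (y / qmax))
        (- Real.exp (-(kThr B Psi Ups T A qmax r β (x / qmax)))) x := by
  have hR : 0 < r ^ β := Real.rpow_pos_of_pos hr β
  have hU : 0 < Ups + 1 := by linarith
  have key := fun u hu => aux_key B Psi Ups T A qmax r β hB hPsi hUps hT hA hr (x / qmax) u hu
  set k := kThr B Psi Ups T A qmax r β (x / qmax)
  have hlin : ∀ y, qmax * (1 - y / qmax) = qmax - y := fun y => by field_simp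
  have hCm : Measurable (fun u => Cchan B Psi Ups r β u * T / A) := by
    unfold Cchan Real.logb
    fun_prop
  have hCn : ∀ u, 0 < u → 0 ≤ Cchan B Psi Ups r β u * T / A := by
    intro u hu
    have : 0 ≤ logb 2 (1 + Psi * u / (r ^ β * (Ups + 1))) := by
      apply Real.logb_nonneg one_lt_two
      have : 0 < Psi * u / (r ^ β * (Ups + 1)) := by positivity
      linarith
    unfold Cchan
    positivity
  simp only [Gfun, hlin] at key ⊢
  set c := fun u => Cchan B Psi Ups r β u * T / A with hc
  have hFm : ∀ y, Measurable (fun u => min (c u) (qmax - y) * Real.exp (-u)) := by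
    intro y; fun_prop
  have hexp : Integrable (fun u : ℝ => Real.exp (-u)) (volume.restrict (Set.Ioi 0)) :=
    integrableOn_exp_neg_Ioi 0
  have main := hasDerivAt_integral_of_dominated_loc_of_lip (μ := volume.restrict (Set.Ioi (0:ℝ)))
    (F := fun y u => min (c u) (qmax - y) * Real.exp (-u)) (x₀ := x) (s := Set.univ)
    (F' := (Set.Ioi k).indicator (fun u => - Real.exp (-u)))
    (bound := fun u => Real.exp (-u)) Filter.univ_mem
    (Filter.Eventually.of_forall fun y => (hFm y).aestronglyMeasurable)
    ?_ ?_ ?_ hexp ?_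
  · have := main.2
    rw [integral_indicator measurableSet_Ioi, Measure.restrict_restrict measurableSet_Ioi,
      Set.Ioi_inter_Ioi, sup_eq_left.2 hk, integral_neg, integral_exp_neg_Ioi] at this
    exact this
  · refine (hexp.const_mul (qmax - x)).mono' (hFm x).aestronglyMeasurable ?_
    filter_upwards [ae_restrict_mem measurableSet_Ioi] with u hu
    have h1 : 0 ≤ min (c u) (qmax - x) := le_min (hCn u hu) (by linarith)
    rw [Real.norm_eq_abs, abs_of_nonneg (by positivity)]
    exact mul_le_mul_of_nonneg_right (min_le_right _ _) (Real.exp_pos _).le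
  · apply Measurable.aestronglyMeasurable
    exact Measurable.indicator (by fun_prop) measurableSet_Ioi
  · refine Filter.Eventually.of_forall fun u => ?_
    apply LipschitzOnWith.of_dist_le_mul
    intro y _ z _
    simp only [Real.dist_eq, Real.coe_nnabs, abs_abs]
    rw [← sub_mul, abs_mul, mul_comm]
    refine mul_le_mul_of_nonneg_left ?_ (abs_nonneg _)
    refine (abs_min_sub_min_le_max _ _ _ _).trans ?_
    simp [abs_sub_comm]
  · have hne : ∀ᵐ u ∂(volume.restrict (Set.Ioi (0:ℝ))), u ≠ k :=
      ae_restrict_of_ae (Measure.ae_ne volume k)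
    filter_upwards [ae_restrict_mem measurableSet_Ioi, hne] with u hu huk
    rcases lt_or_gt_of_ne huk with h | h
    · have h1 : c u < qmax - x := (key u hu).1.2 h
      rw [Set.indicator_of_notMem (by simpa using h.le)]
      refine (hasDerivAt_const x (c u * Real.exp (-u))).congr_of_eventuallyEq ?_
      have : ∀ᶠ y in nhds x, c u < qmax - y :=
        (by fun_prop : Continuous fun y => qmax - y).continuousAt.eventually_const_lt h1
      filter_upwards [this] with y hy
      rw [min_eq_left hy.le]
    · have h1 : qmax - x < c u := (key u hu).2.2 h
      rw [Set.indicator_of_mem (by simpa using h)]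
      have hd : HasDerivAt (fun y => (qmax - y) * Real.exp (-u)) (- Real.exp (-u)) x := by
        simpa using ((hasDerivAt_id x).const_sub qmax).mul_const (Real.exp (-u))
      refine hd.congr_of_eventuallyEq ?_
      have : ∀ᶠ y in nhds x, qmax - y < c u :=
        (by fun_prop : Continuous fun y => qmax - y).continuousAt.eventually_lt_const h1
      filter_upwards [this] with y hy
      rw [min_eq_right hy.le]

theorem stmt_7 (B Psi Ups T A qmax r β : ℝ)
    (hB : 0 < B) (hPsi : 0 < Psi) (hUps : 0 < Ups) (hT : 0 < T)
    (hA : 0 < A) (hq : 0 < qmax) (hr : 0 < r) (hβ : 0 < β) :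
    (∀ x ∈ Set.Ioo (0 : ℝ) qmax,
      HasDerivAt (fun y => y + Gfun B Psi Ups T A qmax r β (y / qmax))
        (1 - Real.exp (-(kThr B Psi Ups T A qmax r β (x / qmax)))) x ∧
      0 < 1 - Real.exp (-(kThr B Psi Ups T A qmax r β (x / qmax))) ∧
      1 - Real.exp (-(kThr B Psi Ups T A qmax r β (x / qmax))) < 1) ∧
    StrictMonoOn (fun y => y + Gfun B Psi Ups T A qmax r β (y / qmax))
      (Set.Icc 0 qmax) := by
  have hR : 0 < r ^ β := Real.rpow_pos_of_pos hr β
  have hU : 0 < Ups + 1 := by linarith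
  have hkp : ∀ x, x < qmax → 0 < kThr B Psi Ups T A qmax r β (x / qmax) := by
    intro x hx
    have h1 : 0 < 1 - x / qmax := by
      have := (div_lt_one hq).2 hx
      linarith
    have : (1:ℝ) < (2 : ℝ) ^ (A * qmax * (1 - x / qmax) / (T * B)) :=
      Real.one_lt_rpow one_lt_two (by positivity)
    unfold kThr
    have h2 := sub_pos.2 this
    positivity
  have hk0 : ∀ x, x ≤ qmax → 0 ≤ kThr B Psi Ups T A qmax r β (x / qmax) := by
    intro x hx
    rcases hx.lt_or_eq with h | h
    · exact (hkp x h).le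
    · subst h
      simp [kThr, hq.ne']
  have hD : ∀ x, x ≤ qmax →
      HasDerivAt (fun y => y + Gfun B Psi Ups T A qmax r β (y / qmax))
        (1 - Real.exp (-(kThr B Psi Ups T A qmax r β (x / qmax)))) x := by
    intro x hx
    have := (hasDerivAt_id x).add
      (aux_deriv B Psi Ups T A qmax r β hB hPsi hUps hT hA hq hr x hx (hk0 x hx))
    rw [sub_eq_add_neg]
    exact this
  have hP : ∀ x, x < qmax → 0 < 1 - Real.exp (-(kThr B Psi Ups T A qmax r β (x / qmax))) := by
    intro x hx
    have := Real.exp_lt_one_iff.2 (neg_lt_zero.2 (hkp x hx))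
    linarith
  refine ⟨fun x hx => ⟨hD x hx.2.le, hP x hx.2, ?_⟩, ?_⟩
  · have := Real.exp_pos (-(kThr B Psi Ups T A qmax r β (x / qmax)))
    linarith
  · apply strictMonoOn_of_deriv_pos (convex_Icc 0 qmax)
    · exact fun x hx => (hD x hx.2).continuousAt.continuousWithinAt
    · intro x hx
      rw [interior_Icc] at hx
      rw [(hD x hx.2.le).deriv]
      exact hP x hx.2
end

section
/- The function Ψ₀(x) := x + H(x/q_max) is concave on [0, q_max], since its derivative x ↦ 1 − ∫₀^R e^{−l(x/q_max)·r^β}·(2r/R²) dr is decreasing in x (because l(x/q_max) is decreasing in x, making the integral increasing in x). -/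
open Real MeasureTheory

/-- Channel capacity `C(u, r) = B·log₂(1 + Ψ·u/(r^β·(Υ+1)))`. -/
noncomputable def Cchan2 (B Psi Ups β : ℝ) (u r : ℝ) : ℝ :=
  B * Real.logb 2 (1 + Psi * u / (r ^ β * (Ups + 1)))

/-- Threshold `l(α) = ((Υ+1)/Ψ)·(2^{A·q_max·(1−α)/(T·B)} − 1)`. -/
noncomputable def lThr (B Psi Ups T A qmax : ℝ) (α : ℝ) : ℝ :=
  ((Ups + 1) / Psi) * ((2 : ℝ) ^ (A * qmax * (1 - α) / (T * B)) - 1)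

/-- Averaged expected delivered quality
`H(α) = ∫₀^R [∫₀^∞ min{C(u,r)·T/A, q_max·(1−α)}·e^{−u} du]·(2r/R²) dr`. -/
noncomputable def Hfun (B Psi Ups T A qmax R β : ℝ) (α : ℝ) : ℝ :=
  ∫ r in (0 : ℝ)..R,
    (∫ u in Set.Ioi (0 : ℝ),
      min (Cchan2 B Psi Ups β u r * T / A) (qmax * (1 - α)) * Real.exp (-u)) *
    (2 * r / R ^ 2)

lemma aux_nonneg (B Psi Ups T A β : ℝ)
    (hB : 0 < B) (hPsi : 0 < Psi) (hUps : 0 < Ups) (hT : 0 < T)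
    (hA : 0 < A) (u r : ℝ) (hu : 0 < u) (hr : 0 ≤ r) :
    0 ≤ Cchan2 B Psi Ups β u r * T / A := by
  unfold Cchan2
  have h : 0 ≤ Psi * u / (r ^ β * (Ups + 1)) := by
    have := Real.rpow_nonneg hr β
    positivity
  have h2 : 0 ≤ Real.logb 2 (1 + Psi * u / (r ^ β * (Ups + 1))) :=
    Real.logb_nonneg (by norm_num) (by linarith)
  positivity

lemma aux_meas (B Psi Ups T A β m : ℝ) :
    Measurable (fun p : ℝ × ℝ =>
      min (Cchan2 B Psi Ups β p.2 p.1 * T / A) m * Real.exp (-p.2)) := by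
  unfold Cchan2 Real.logb
  fun_prop

lemma aux_exp : IntegrableOn (fun u : ℝ => Real.exp (-u)) (Set.Ioi 0) := by
  simpa using integrableOn_exp_neg_Ioi 0

lemma aux_int (B Psi Ups T A β : ℝ)
    (hB : 0 < B) (hPsi : 0 < Psi) (hUps : 0 < Ups) (hT : 0 < T)
    (hA : 0 < A) (r m : ℝ) (hr : 0 ≤ r) (hm : 0 ≤ m) :
    IntegrableOn (fun u => min (Cchan2 B Psi Ups β u r * T / A) m * Real.exp (-u))
      (Set.Ioi 0) := by
  refine Integrable.mono' (aux_exp.const_mul m) ?_ ?_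
  · exact ((aux_meas B Psi Ups T A β m).comp measurable_prodMk_left).aestronglyMeasurable
  · filter_upwards [ae_restrict_mem measurableSet_Ioi] with u hu
    have h1 := aux_nonneg B Psi Ups T A β hB hPsi hUps hT hA u r hu hr
    rw [Real.norm_of_nonneg (mul_nonneg (le_min h1 hm) (Real.exp_pos _).le)]
    gcongr
    exact min_le_right _ _

lemma aux_int2 (B Psi Ups T A R β : ℝ)
    (hB : 0 < B) (hPsi : 0 < Psi) (hUps : 0 < Ups) (hT : 0 < T)
    (hA : 0 < A) (hR : 0 < R) (m : ℝ) (hm : 0 ≤ m) :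
    IntervalIntegrable (fun r => (∫ u in Set.Ioi (0 : ℝ),
      min (Cchan2 B Psi Ups β u r * T / A) m * Real.exp (-u)) *
    (2 * r / R ^ 2)) volume 0 R := by
  have hc : IntervalIntegrable (fun r : ℝ => m * (2 * r / R ^ 2)) volume 0 R :=
    Continuous.intervalIntegrable (by fun_prop) _ _
  refine hc.mono_fun' ?_ ?_
  · have h1 : StronglyMeasurable (fun r => ∫ u in Set.Ioi (0 : ℝ),
      min (Cchan2 B Psi Ups β u r * T / A) m * Real.exp (-u)) :=
      StronglyMeasurable.integral_prod_right'
        (aux_meas B Psi Ups T A β m).stronglyMeasurable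
    have h2 : Measurable (fun r : ℝ => 2 * r / R ^ 2) := by fun_prop
    exact (h1.measurable.mul h2).aestronglyMeasurable
  · filter_upwards [ae_restrict_mem measurableSet_uIoc] with r hr
    rw [Set.uIoc_of_le hR.le] at hr
    have hr0 : 0 ≤ r := hr.1.le
    have h0 : 0 ≤ ∫ u in Set.Ioi (0 : ℝ),
        min (Cchan2 B Psi Ups β u r * T / A) m * Real.exp (-u) := by
      refine setIntegral_nonneg measurableSet_Ioi fun u hu => ?_
      exact mul_nonneg (le_min (aux_nonneg B Psi Ups T A β hB hPsi hUps hT hA u r hu hr0) hm)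
        (Real.exp_pos _).le
    have h1 : ∫ u in Set.Ioi (0 : ℝ),
        min (Cchan2 B Psi Ups β u r * T / A) m * Real.exp (-u) ≤ m := by
      calc _ ≤ ∫ u in Set.Ioi (0 : ℝ), m * Real.exp (-u) := by
            refine setIntegral_mono_on (aux_int B Psi Ups T A β hB hPsi hUps hT hA r m hr0 hm)
              (aux_exp.const_mul m) measurableSet_Ioi fun u hu => ?_
            gcongr
            exact min_le_right _ _
        _ = m := by
            rw [integral_const_mul, integral_exp_neg_Ioi]; simp
    have h2 : 0 ≤ 2 * r / R ^ 2 := by positivity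
    rw [Real.norm_of_nonneg (mul_nonneg h0 h2)]
    gcongr

theorem stmt_18 (B Psi Ups T A qmax R β : ℝ)
    (hB : 0 < B) (hPsi : 0 < Psi) (hUps : 0 < Ups) (hT : 0 < T)
    (hA : 0 < A) (hq : 0 < qmax) (hR : 0 < R) (hβ : 0 < β) :
    AntitoneOn
      (fun x => 1 - ∫ r in (0 : ℝ)..R,
        Real.exp (-(lThr B Psi Ups T A qmax (x / qmax) * r ^ β)) * (2 * r / R ^ 2))
      (Set.Icc 0 qmax) ∧
    ConcaveOn ℝ (Set.Icc 0 qmax)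
      (fun x => x + Hfun B Psi Ups T A qmax R β (x / qmax)) := by
  constructor
  · intro x hx y hy hxy
    have hcont : ∀ z : ℝ, IntervalIntegrable (fun r : ℝ =>
        Real.exp (-(lThr B Psi Ups T A qmax (z / qmax) * r ^ β)) * (2 * r / R ^ 2))
        volume 0 R := by
      intro z
      have : Continuous (fun r : ℝ => r ^ β) := Real.continuous_rpow_const hβ.le
      exact Continuous.intervalIntegrable (by fun_prop) _ _
    apply sub_le_sub_left
    refine intervalIntegral.integral_mono_on hR.le (hcont x) (hcont y) fun r hr => ?_
    have hr0 := hr.1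
    have hrb := Real.rpow_nonneg hr0 β
    have hl : lThr B Psi Ups T A qmax (y / qmax) ≤ lThr B Psi Ups T A qmax (x / qmax) := by
      unfold lThr
      have : (1:ℝ) ≤ 2 := by norm_num
      gcongr
    gcongr
  · refine ConcaveOn.add (concaveOn_id (convex_Icc 0 qmax)) ?_
    refine ⟨convex_Icc 0 qmax, ?_⟩
    intro x hx y hy a b ha hb hab
    have hz := convex_Icc 0 qmax hx hy ha hb hab
    have key : ∀ z ∈ Set.Icc 0 qmax, qmax * (1 - z / qmax) = qmax - z ∧ 0 ≤ qmax - z := by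
      intro z hz
      refine ⟨by field_simp, by linarith [hz.2]⟩
    simp only [smul_eq_mul] at hz ⊢
    unfold Hfun
    rw [(key x hx).1, (key y hy).1, (key _ hz).1]
    have I := fun m hm => aux_int2 B Psi Ups T A R β hB hPsi hUps hT hA hR m hm
    have J := fun r m hr hm => aux_int B Psi Ups T A β hB hPsi hUps hT hA r m hr hm
    have Ix := I _ (key x hx).2
    have Iy := I _ (key y hy).2
    have Iz := I _ (key _ hz).2
    rw [← intervalIntegral.integral_const_mul, ← intervalIntegral.integral_const_mul,
      ← intervalIntegral.integral_add (Ix.const_mul a) (Iy.const_mul b)]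
    refine intervalIntegral.integral_mono_on hR.le
      ((Ix.const_mul a).add (Iy.const_mul b)) Iz fun r hr => ?_
    have hr0 := hr.1
    rw [← mul_assoc, ← mul_assoc, ← add_mul]
    refine mul_le_mul_of_nonneg_right ?_ (by positivity)
    have Jx := J r _ hr0 (key x hx).2
    have Jy := J r _ hr0 (key y hy).2
    have Jz := J r _ hr0 (key _ hz).2
    rw [← integral_const_mul, ← integral_const_mul,
      ← integral_add (Jx.const_mul a) (Jy.const_mul b)]
    refine setIntegral_mono_on ((Jx.const_mul a).add (Jy.const_mul b)) Jz
      measurableSet_Ioi fun u hu => ?_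
    rw [← mul_assoc, ← mul_assoc, ← add_mul]
    refine mul_le_mul_of_nonneg_right ?_ (Real.exp_pos _).le
    set c := Cchan2 B Psi Ups β u r * T / A
    have hb' : b = 1 - a := by linarith
    apply le_min
    · calc _ ≤ a * c + b * c := by gcongr <;> exact min_le_left _ _
        _ = c := by rw [hb']; ring
    · calc _ ≤ a * (qmax - x) + b * (qmax - y) := by gcongr <;> exact min_le_right _ _
        _ = _ := by rw [hb']; ring
end
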